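/- arXiv:2004.14431 — 4 statements merged into one kernel-verified Lean document; each statement's English description precedes it below -/
import Mathlib

section
/- Let M be a metric space, X a continuous flow on M, and φ : M → ℝ a Hölder continuous function: there are constants H ≥ 0 and a > 0 with |φ(p) − φ(q)| ≤ H · (dist p q)^a for all p, q ∈ M. Suppose x, y ∈ M lie on the same stable leaf in the sense that there are constants C ≥ 0 and λ > 0 with dist(X^t x, X^t y) ≤ C · exp(−λ t) for all t ≥ 0. Then the function t ↦ φ(X^t x) − φ(X^t y) is integrable on [0, ∞), i.e. the periodic cycle functional PCF(φ) = ∫₀^∞ (φ(X^t x) − φ(X^t y)) dt over the stable leg from x to y converges. -/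
open MeasureTheory

theorem continuous_of_abs_sub_le_mul_dist_rpow {M : Type*} [PseudoMetricSpace M] {φ : M → ℝ}
    {H a : ℝ} (ha : 0 < a) (hφ : ∀ p q : M, |φ p - φ q| ≤ H * dist p q ^ a) :
    Continuous φ := by
  refine continuous_iff_continuousAt.2 fun q => tendsto_iff_dist_tendsto_zero.2 ?_
  have hcont : Continuous fun p : M => H * dist p q ^ a :=
    continuous_const.mul ((continuous_id.dist continuous_const).rpow_const fun _ => Or.inr ha.le)
  have hlim := hcont.tendsto q
  simp only [dist_self, Real.zero_rpow ha.ne', mul_zero] at hlim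
  exact squeeze_zero (fun _ => dist_nonneg) (fun p => hφ p q) hlim

/-- **Convergence of the periodic cycle functional over a stable leg.**
If `φ` is Hölder continuous and `x, y` lie on the same stable leaf
(their orbits approach each other exponentially), then
`t ↦ φ(X^t x) − φ(X^t y)` is integrable on `[0, ∞)`. -/
theorem pcf_stable_leg_integrable
    {M : Type*} [MetricSpace M] (X : Flow ℝ M) (φ : M → ℝ)
    (H a : ℝ) (hH : 0 ≤ H) (ha : 0 < a)
    (hφ : ∀ p q : M, |φ p - φ q| ≤ H * dist p q ^ a)
    (x y : M) (C lam : ℝ) (hC : 0 ≤ C) (hlam : 0 < lam)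
    (hstable : ∀ t : ℝ, 0 ≤ t → dist (X t x) (X t y) ≤ C * Real.exp (-lam * t)) :
    IntegrableOn (fun t : ℝ => φ (X t x) - φ (X t y)) (Set.Ici 0) := by
  have hcφ := continuous_of_abs_sub_le_mul_dist_rpow ha hφ
  have hcont : Continuous fun t : ℝ => φ (X t x) - φ (X t y) :=
    (hcφ.comp (X.continuous continuous_id continuous_const)).sub
      (hcφ.comp (X.continuous continuous_id continuous_const))
  rw [integrableOn_Ici_iff_integrableOn_Ioi]
  refine ((exp_neg_integrableOn_Ioi 0 (mul_pos hlam ha)).const_mul (H * C ^ a)).mono'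
    hcont.aestronglyMeasurable ?_
  filter_upwards [ae_restrict_mem measurableSet_Ioi] with t ht
  calc |φ (X t x) - φ (X t y)| ≤ H * dist (X t x) (X t y) ^ a := hφ _ _
    _ ≤ H * (C * Real.exp (-lam * t)) ^ a := by
      gcongr
      exact hstable t (Set.mem_Ioi.1 ht).le
    _ = H * C ^ a * Real.exp (-(lam * a) * t) := by
      rw [Real.mul_rpow hC (Real.exp_pos _).le, ← Real.exp_mul, ← mul_assoc]
      ring_nf
end

section
/- Let M be a metric space, X a continuous flow on M, and φ : M → ℝ Hölder continuous with constants H ≥ 0, a > 0. Let u : M → ℝ be uniformly continuous and suppose φ is the derivative of u along the flow: for every z ∈ M and every t ∈ ℝ, the map s ↦ u(X^s z) is differentiable at t with derivative φ(X^t z). Suppose x, y ∈ M satisfy dist(X^t x, X^t y) ≤ C · exp(−λ t) for all t ≥ 0, with C ≥ 0 and λ > 0. Then ∫₀^∞ (φ(X^t x) − φ(X^t y)) dt = u(y) − u(x); that is, the periodic cycle functional of a coboundary over a stable leg equals the difference of the transfer function at its endpoints. -/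
open MeasureTheory

/-- **The periodic cycle functional of a coboundary over a stable leg equals the
difference of the transfer function at the endpoints.** -/
theorem pcf_coboundary_stable_leg
    {M : Type*} [MetricSpace M] (X : Flow ℝ M) (φ u : M → ℝ)
    (H a : ℝ) (hH : 0 ≤ H) (ha : 0 < a)
    (hφ : ∀ p q : M, |φ p - φ q| ≤ H * dist p q ^ a)
    (hu : UniformContinuous u)
    (hderiv : ∀ (z : M) (t : ℝ), HasDerivAt (fun s : ℝ => u (X s z)) (φ (X t z)) t)
    (x y : M) (C lam : ℝ) (hC : 0 ≤ C) (hlam : 0 < lam)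
    (hstable : ∀ t : ℝ, 0 ≤ t → dist (X t x) (X t y) ≤ C * Real.exp (-lam * t)) :
    ∫ t in Set.Ici (0 : ℝ), (φ (X t x) - φ (X t y)) = u y - u x := by
  have hdiff (t : ℝ) : HasDerivAt (fun s : ℝ => u (X s x) - u (X s y))
      (φ (X t x) - φ (X t y)) t := (hderiv x t).sub (hderiv y t)
  have hint : IntegrableOn (fun t : ℝ => φ (X t x) - φ (X t y)) (Set.Ioi 0) := by
    have hmeas : Measurable fun t : ℝ => φ (X t x) - φ (X t y) := by
      rw [← funext fun t => (hdiff t).deriv]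
      exact measurable_deriv _
    refine ((exp_neg_integrableOn_Ioi 0 (mul_pos hlam ha)).const_mul (H * C ^ a)).mono'
      hmeas.aestronglyMeasurable ((ae_restrict_mem measurableSet_Ioi).mono fun t ht => ?_)
    calc ‖φ (X t x) - φ (X t y)‖ ≤ H * dist (X t x) (X t y) ^ a := hφ _ _
      _ ≤ H * (C * Real.exp (-lam * t)) ^ a := by
        gcongr
        exact hstable t (le_of_lt ht)
      _ = H * C ^ a * Real.exp (-(lam * a) * t) := by
        rw [Real.mul_rpow hC (Real.exp_pos _).le, ← Real.exp_mul, mul_assoc]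
        ring_nf
  have hdist : Filter.Tendsto (fun t : ℝ => dist (X t x) (X t y)) Filter.atTop (nhds 0) := by
    have hexp : Filter.Tendsto (fun t : ℝ => C * Real.exp (-lam * t)) Filter.atTop (nhds 0) := by
      simpa using (Real.tendsto_exp_atBot.comp
        (Filter.tendsto_id.const_mul_atTop_of_neg (neg_neg_of_pos hlam))).const_mul C
    exact squeeze_zero' (Filter.Eventually.of_forall fun _ => dist_nonneg)
      ((Filter.eventually_ge_atTop 0).mono hstable) hexp
  have hlim : Filter.Tendsto (fun t : ℝ => u (X t x) - u (X t y)) Filter.atTop (nhds 0) := by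
    have hunif := Filter.Tendsto.comp hu (tendsto_uniformity_iff_dist_tendsto_zero
      (f := fun t : ℝ => (X t x, X t y)).2 hdist)
    rw [tendsto_zero_iff_norm_tendsto_zero]
    exact tendsto_uniformity_iff_dist_tendsto_zero.1 hunif
  rw [integral_Ici_eq_integral_Ioi,
    integral_Ioi_of_hasDerivAt_of_tendsto' (fun t _ => hdiff t) hint hlim]
  simp
end

section
/- Let M be a topological space, let X and Z be continuous flows on M, let ℓ : M → ℝ be continuous, and let τ : ℝ × M → ℝ be given by τ_t(x) = ∫₀^t ℓ(Z^s x) ds. Assume Z is the reparametrization of X by ℓ in the sense that Z^t x = X^{τ_t(x)} x for all t, x. Suppose u : M → ℝ is such that for every x ∈ M and every t ∈ ℝ the map s ↦ u(Z^s x) is differentiable at t with derivative 1 − ℓ(Z^t x). Then the time-u map h(x) := X^{u(x)} x conjugates the flows: h(Z^t x) = X^t(h(x)) for all t ∈ ℝ and x ∈ M. -/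
/-- **A time-change is conjugate to the original flow via a time-`u` map.**
If `Z = ℓ X` is a reparametrization of `X` and `u` solves the (integrated)
cohomological equation `L_Z u = 1 − ℓ`, then `h(x) = X^{u(x)} x` conjugates
`Z` to `X`: `h ∘ Z^t = X^t ∘ h`. -/
theorem time_change_conjugacy
    {M : Type*} [TopologicalSpace M] (X Z : Flow ℝ M)
    (ℓ : M → ℝ) (hℓ : Continuous ℓ)
    (τ : ℝ → M → ℝ) (hτ : ∀ (t : ℝ) (x : M), τ t x = ∫ s in (0:ℝ)..t, ℓ (Z s x))
    (hrep : ∀ (t : ℝ) (x : M), Z t x = X (τ t x) x)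
    (u : M → ℝ)
    (hu : ∀ (x : M) (t : ℝ),
      HasDerivAt (fun s : ℝ => u (Z s x)) (1 - ℓ (Z t x)) t) :
    ∀ (t : ℝ) (x : M), X (u (Z t x)) (Z t x) = X t (X (u x) x) := by
  intro t x
  have hcont : Continuous fun s : ℝ => ℓ (Z s x) :=
    hℓ.comp (Z.continuous continuous_id continuous_const)
  have hftc : ∫ s in (0:ℝ)..t, (1 - ℓ (Z s x)) = u (Z t x) - u (Z 0 x) :=
    intervalIntegral.integral_eq_sub_of_hasDerivAt (fun s _ => hu x s)
      ((continuous_const.sub hcont).intervalIntegrable 0 t)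
  rw [intervalIntegral.integral_sub intervalIntegrable_const (hcont.intervalIntegrable 0 t),
    ← hτ, intervalIntegral.integral_const, smul_eq_mul, Z.map_zero_apply] at hftc
  have hadd : u (Z t x) + τ t x = t + u x := by linarith
  calc X (u (Z t x)) (Z t x) = X (u (Z t x)) (X (τ t x) x) := congrArg _ (hrep t x)
    _ = X t (X (u x) x) := by rw [← X.map_add, hadd, X.map_add]
end

section
/- Let M be a topological space equipped with its Borel σ-algebra, let μ be a finite measure on M, and let X be a continuous flow on M such that every time-t map preserves μ: the pushforward of μ under X^t equals μ for all t ∈ ℝ. Let u : M → ℝ be bounded and continuous, and let φ : M → ℝ be bounded and continuous such that for every x ∈ M and every t ∈ ℝ, the map s ↦ u(X^s x) is differentiable at t with derivative φ(X^t x). Then ∫_M φ dμ = 0. -/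
open MeasureTheory

/-- **The integral of a Lie derivative against an invariant measure vanishes.**
If a finite measure `μ` is invariant under every time-`t` map of a flow `X`,
`u` is bounded continuous and `φ` is bounded continuous with
`φ = L_X u` (in the integrated sense), then `∫ φ dμ = 0`. -/
theorem integral_lie_derivative_eq_zero
    {M : Type*} [TopologicalSpace M] [MeasurableSpace M] [BorelSpace M]
    (μ : Measure M) [IsFiniteMeasure μ]
    (X : Flow ℝ M) (hinv : ∀ t : ℝ, Measure.map (X t) μ = μ)
    (u φ : M → ℝ)
    (hu_cont : Continuous u) (hu_bdd : ∃ Cu : ℝ, ∀ x : M, |u x| ≤ Cu)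
    (hφ_cont : Continuous φ) (hφ_bdd : ∃ Cφ : ℝ, ∀ x : M, |φ x| ≤ Cφ)
    (hderiv : ∀ (x : M) (t : ℝ), HasDerivAt (fun s : ℝ => u (X s x)) (φ (X t x)) t) :
    ∫ x, φ x ∂μ = 0 := by
  obtain ⟨Cu, hCu⟩ := hu_bdd
  obtain ⟨Cφ, hCφ⟩ := hφ_bdd
  have hX (t : ℝ) : Continuous (X t) := X.continuous continuous_const continuous_id
  have hconst (t : ℝ) : ∫ x, u (X t x) ∂μ = ∫ x, u x ∂μ := by
    rw [← integral_map (hX t).measurable.aemeasurable hu_cont.measurable.aestronglyMeasurable,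
      hinv t]
  have h := (hasDerivAt_integral_of_dominated_loc_of_deriv_le (μ := μ) (x₀ := (0 : ℝ))
    (s := Set.univ) (F := fun t x => u (X t x)) (F' := fun t x => φ (X t x))
    (bound := fun _ => Cφ) Filter.univ_mem
    (.of_forall fun t => (hu_cont.comp (hX t)).measurable.aestronglyMeasurable)
    (.of_bound (hu_cont.comp (hX 0)).measurable.aestronglyMeasurable Cu
      (.of_forall fun x => hCu (X 0 x)))
    (hφ_cont.comp (hX 0)).measurable.aestronglyMeasurable
    (.of_forall fun x t _ => hCφ (X t x)) (integrable_const _)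
    (.of_forall fun x t _ => hderiv x t)).2
  simp only [hconst, X.map_zero_apply] at h
  exact h.unique (hasDerivAt_const 0 _)
end
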